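/- Let n ≥ 3, let 2 ≤ k ≤ n−1, let U ⊆ ℝⁿ be open, and let σ be a smooth map from U to k-forms satisfying the flat conformal Killing equation. Define the codifferential-type (k−1)-form (δσ)(x)(a₂,…,aₖ) := Σ_{p=1}^{n} (Dσ(x)eₚ)(eₚ,a₂,…,aₖ). Then δσ is a Killing (k−1)-form: there exists a smooth map ρ′ from U to k-forms such that for all x ∈ U and all c, a₂, …, aₖ ∈ ℝⁿ, (D(δσ)(x)c)(a₂,…,aₖ) = ρ′(x)(c,a₂,…,aₖ). In particular δσ satisfies the flat conformal Killing equation for (k−1)-forms and is coclosed. (This is the Euclidean instance, with Einstein scale α ≡ 1 and vanishing Weyl curvature, of the helicity-lowering theorem on almost Einstein manifolds.) -/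

import Mathlib

open scoped RealInnerProductSpace BigOperators

noncomputable section

/-- Euclidean `n`-space. -/
abbrev Euc (n : ℕ) : Type := EuclideanSpace ℝ (Fin n)

/-- Continuous `k`-linear maps `(ℝⁿ)ᵏ → ℝ`. -/
abbrev FormML (n k : ℕ) : Type :=
  ContinuousMultilinearMap ℝ (fun _ : Fin k => Euc n) ℝ

/-- A multilinear map is alternating (vanishes when two arguments coincide);
together with multilinearity this makes it a `k`-form. -/
def IsAlt {n k : ℕ} (f : FormML n k) : Prop :=
  ∀ (v : Fin k → Euc n) (i j : Fin k), i ≠ j → v i = v j → f v = 0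

/-- The tuple `a` with its `i`-th entry omitted. -/
def omitArg {X : Type*} {k : ℕ} (i : Fin k) (a : Fin k → X) (j : Fin (k - 1)) : X :=
  if (j : ℕ) < (i : ℕ) then a ⟨j, by have := j.isLt; have := i.isLt; omega⟩
  else a ⟨(j : ℕ) + 1, by have := j.isLt; omega⟩

/-- The tuple `(c, d₁, …, d_{k-1})`. -/
def consCast {X : Type*} {k : ℕ} (c : X) (d : Fin (k - 1) → X) (j : Fin k) : X :=
  if h : (j : ℕ) = 0 then c else d ⟨(j : ℕ) - 1, by have := j.isLt; omega⟩

/-- The flat (Euclidean) conformal Killing equation on `k`-forms: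
`σ` is smooth on `U`, valued in alternating maps, and there are smooth form-valued
`τ` (degree `k-1`) and `ρ` (degree `k+1`) with
`(Dσ(x)c)(a₁,…,a_k) = Σᵢ (-1)^(i+1) ⟨c,aᵢ⟩ τ(x)(a₁,…,âᵢ,…,a_k) + ρ(x)(c,a₁,…,a_k)`. -/
def FlatCKF (n k : ℕ) (U : Set (Euc n)) (σ : Euc n → FormML n k) : Prop :=
  ContDiffOn ℝ (⊤ : ℕ∞) σ U ∧ (∀ x ∈ U, IsAlt (σ x)) ∧
  ∃ (τ : Euc n → FormML n (k - 1)) (ρ : Euc n → FormML n (k + 1)),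
    ContDiffOn ℝ (⊤ : ℕ∞) τ U ∧ ContDiffOn ℝ (⊤ : ℕ∞) ρ U ∧
    (∀ x ∈ U, IsAlt (τ x)) ∧ (∀ x ∈ U, IsAlt (ρ x)) ∧
    ∀ x ∈ U, ∀ (c : Euc n) (a : Fin k → Euc n),
      (fderiv ℝ σ x c) a =
        (∑ i : Fin k, (-1 : ℝ) ^ (i : ℕ) * ⟪c, a i⟫ * τ x (omitArg i a))
        + ρ x (consCast c a)


variable {n m : ℕ}

namespace IsAlt

/-- The alternating map underlying an alternating continuous multilinear map. -/
def toAlternatingMap {f : FormML n m} (hf : IsAlt f) : Euc n [⋀^Fin m]→ₗ[ℝ] ℝ :=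
  { f.toMultilinearMap with
    map_eq_zero_of_eq' := fun v i j hv hij => hf v i j hij hv }

theorem map_insertNth {f : FormML n (m + 1)} (hf : IsAlt f) (p : Fin (m + 1)) (x : Euc n)
    (v : Fin m → Euc n) :
    f (p.insertNth x v) = (-1 : ℝ) ^ (p : ℕ) * f (Fin.cons x v) := by
  have h := hf.toAlternatingMap.map_insertNth p x v
  rw [← Int.cast_smul_eq_zsmul ℝ] at h
  simpa only [Int.cast_pow, Int.cast_neg, Int.cast_one, smul_eq_mul] using! h

theorem map_cons_removeNth {f : FormML n (m + 1)} (hf : IsAlt f) (p : Fin (m + 1))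
    (v : Fin (m + 1) → Euc n) :
    (-1 : ℝ) ^ (p : ℕ) * f (Fin.cons (v p) (p.removeNth v)) = f v := by
  rw [← hf.map_insertNth, Fin.insertNth_self_removeNth]

theorem map_cons_cons_swap {f : FormML n (m + 2)} (hf : IsAlt f) (x y : Euc n)
    (v : Fin m → Euc n) :
    f (Fin.cons x (Fin.cons y v)) = -f (Fin.cons y (Fin.cons x v)) := by
  have h := hf.map_cons_removeNth (m := m + 1) 1 (Fin.cons x (Fin.cons y v))
  have hv : (1 : Fin (m + 2)).removeNth (Fin.cons x (Fin.cons y v) : Fin (m + 2) → Euc n)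
      = Fin.cons x v := by
    ext j : 1
    refine Fin.cases ?_ (fun i => ?_) j
    · simp [Fin.removeNth]
    · simp only [Fin.removeNth, Fin.one_succAbove_succ, Fin.cons_succ]
  rw [hv] at h
  simpa using h.symm

theorem map_cons_cons_self {f : FormML n (m + 2)} (hf : IsAlt f) (x : Euc n)
    (v : Fin m → Euc n) : f (Fin.cons x (Fin.cons x v)) = 0 :=
  hf _ 0 1 (by simp) rfl

end IsAlt

/-- The value at `a` of the wedge product of the covector `⟪c, ·⟫` with `τ`. -/
def covectorWedge (c : Euc n) (τ : FormML n m) (a : Fin (m + 1) → Euc n) : ℝ :=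
  ∑ i : Fin (m + 1), (-1 : ℝ) ^ (i : ℕ) * ⟪c, a i⟫ * τ (i.removeNth a)

theorem removeNth_succ_cons {X : Type*} (i : Fin (m + 1)) (c : X) (d : Fin (m + 1) → X) :
    i.succ.removeNth (Fin.cons c d : Fin (m + 2) → X) = Fin.cons c (i.removeNth d) := by
  ext j
  exact congrFun (Fin.cons_comp_succ_succAbove c d i) j

theorem covectorWedge_cons (b c : Euc n) (τ : FormML n (m + 1)) (d : Fin (m + 1) → Euc n) :
    covectorWedge b τ (Fin.cons c d) =
      ⟪b, c⟫ * τ d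
        - ∑ i : Fin (m + 1), (-1 : ℝ) ^ (i : ℕ) * ⟪b, d i⟫ * τ (Fin.cons c (i.removeNth d)) := by
  rw [covectorWedge, Fin.sum_univ_succ, sub_eq_add_neg, ← Finset.sum_neg_distrib]
  congr 1
  · simp
  · refine Finset.sum_congr rfl fun i _ => ?_
    rw [removeNth_succ_cons, Fin.cons_succ, Fin.val_succ, pow_succ]
    ring

theorem sum_inner_smul_single {F : Type*} [AddCommGroup F] [Module ℝ F] (L : Euc n →ₗ[ℝ] F)
    (x : Euc n) :
    ∑ p : Fin n, ⟪EuclideanSpace.single p (1 : ℝ), x⟫ • L (EuclideanSpace.single p 1) = L x := by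
  conv_rhs => rw [← (EuclideanSpace.basisFun (Fin n) ℝ).sum_repr' x]
  simp

theorem sum_inner_mul_cons (τ : FormML n (m + 1)) (x : Euc n) (v : Fin m → Euc n) :
    ∑ p : Fin n, ⟪EuclideanSpace.single p (1 : ℝ), x⟫ *
      τ (Fin.cons (EuclideanSpace.single p 1) v) = τ (Fin.cons x v) :=
  sum_inner_smul_single
    { toFun := fun y => τ (Fin.cons y v)
      map_add' := fun y z => τ.cons_add v y z
      map_smul' := fun c y => τ.cons_smul v c y } x

theorem sum_covectorWedge_single {τ : FormML n (m + 1)} (hτ : IsAlt τ)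
    (d : Fin (m + 1) → Euc n) :
    ∑ p : Fin n, covectorWedge (EuclideanSpace.single p (1 : ℝ)) τ
      (Fin.cons (EuclideanSpace.single p 1) d) = ((n : ℝ) - (m + 1)) * τ d := by
  simp_rw [covectorWedge_cons, Finset.sum_sub_distrib]
  rw [Finset.sum_comm]
  have h : ∀ i : Fin (m + 1), ∑ p : Fin n, (-1 : ℝ) ^ (i : ℕ) *
      ⟪EuclideanSpace.single p (1 : ℝ), d i⟫ *
        τ (Fin.cons (EuclideanSpace.single p 1) (i.removeNth d)) = τ d := fun i => by
    simp_rw [mul_assoc]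
    rw [← Finset.mul_sum, sum_inner_mul_cons, hτ.map_cons_removeNth]
  simp_rw [h]
  simp
  ring

section SecondOrder

variable {T : Euc n →L[ℝ] FormML n (m + 1)} {R : Euc n →L[ℝ] FormML n (m + 3)}
  {S : Euc n →L[ℝ] Euc n →L[ℝ] FormML n (m + 2)}

theorem sum_second_derivative_single (hT : ∀ b, IsAlt (T b)) (hR : ∀ b, IsAlt (R b))
    (hS : ∀ b c a, S b c a = covectorWedge c (T b) a + R b (Fin.cons c a))
    (b : Euc n) (d : Fin (m + 1) → Euc n) :
    ∑ p : Fin n, S b (EuclideanSpace.single p 1) (Fin.cons (EuclideanSpace.single p 1) d)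
      = ((n : ℝ) - (m + 1)) * T b d := by
  simp_rw [hS, (hR b).map_cons_cons_self, add_zero]
  exact sum_covectorWedge_single (hT b) d

theorem divergence_eq_zero (hmn : m + 2 < n)
    (hT : ∀ b, IsAlt (T b)) (hR : ∀ b, IsAlt (R b)) (hSalt : ∀ b c, IsAlt (S b c))
    (hSsymm : ∀ b c, S b c = S c b)
    (hS : ∀ b c a, S b c a = covectorWedge c (T b) a + R b (Fin.cons c a))
    (d : Fin m → Euc n) :
    ∑ p : Fin n, T (EuclideanSpace.single p 1) (Fin.cons (EuclideanSpace.single p 1) d) = 0 := by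
  have hc : (n : ℝ) - (m + 1) ≠ 0 := by
    have : (m : ℝ) + 2 < n := by exact_mod_cast hmn
    linarith
  refine (mul_eq_zero.mp ?_).resolve_left hc
  rw [Finset.mul_sum]
  simp_rw [← sum_second_derivative_single hT hR hS]
  refine self_eq_neg.mp ?_
  conv_lhs => rw [Finset.sum_comm]
  simp_rw [← Finset.sum_neg_distrib]
  refine Finset.sum_congr rfl fun p _ => Finset.sum_congr rfl fun q _ => ?_
  rw [hSsymm, (hSalt _ _).map_cons_cons_swap]

theorem first_derivative_eq_divergence (hmn : m + 2 < n)
    (hT : ∀ b, IsAlt (T b)) (hR : ∀ b, IsAlt (R b)) (hSalt : ∀ b c, IsAlt (S b c))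
    (hSsymm : ∀ b c, S b c = S c b)
    (hS : ∀ b c a, S b c a = covectorWedge c (T b) a + R b (Fin.cons c a))
    (b : Euc n) (d : Fin (m + 1) → Euc n) :
    ((n : ℝ) - (m + 2)) * T b d = -∑ p : Fin n, R (EuclideanSpace.single p 1)
      (Fin.cons (EuclideanSpace.single p 1) (Fin.cons b d)) := by
  have hwedge : ∑ p : Fin n, covectorWedge b (T (EuclideanSpace.single p 1))
      (Fin.cons (EuclideanSpace.single p 1) d) = T b d := by
    simp_rw [covectorWedge_cons, Finset.sum_sub_distrib]
    rw [Finset.sum_comm]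
    simp_rw [← Finset.mul_sum, divergence_eq_zero hmn hT hR hSalt hSsymm hS]
    simp only [mul_zero, Finset.sum_const_zero, sub_zero]
    have h := congrArg (fun f : FormML n (m + 1) => f d)
      (sum_inner_smul_single T.toLinearMap b)
    simp only [sum_apply, smul_apply,
      smul_eq_mul, ContinuousLinearMap.coe_coe] at h
    simpa only [real_inner_comm] using h
  have hswap : ∑ p : Fin n, S b (EuclideanSpace.single p 1)
      (Fin.cons (EuclideanSpace.single p 1) d) = T b d - ∑ p : Fin n, R (EuclideanSpace.single p 1)
        (Fin.cons (EuclideanSpace.single p 1) (Fin.cons b d)) := by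
    simp_rw [hSsymm b, hS, Finset.sum_add_distrib]
    rw [hwedge, sub_eq_add_neg, ← Finset.sum_neg_distrib]
    congr 1
    exact Finset.sum_congr rfl fun p _ => (hR _).map_cons_cons_swap _ _ _
  rw [sum_second_derivative_single hT hR hS] at hswap
  linear_combination hswap

end SecondOrder

section Derivatives

variable {U : Set (Euc n)}

theorem fderiv_form_apply {f : Euc n → FormML n m} {x : Euc n} (hf : DifferentiableAt ℝ f x)
    (v : Fin m → Euc n) (c : Euc n) : fderiv ℝ (fun y => f y v) x c = fderiv ℝ f x c v := by
  have h := ((ContinuousMultilinearMap.apply ℝ (fun _ : Fin m => Euc n) ℝ v).hasFDerivAt.comp x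
    hf.hasFDerivAt).fderiv
  exact congrArg (fun L => L c) h

theorem DifferentiableAt.form_apply {f : Euc n → FormML n m} {x : Euc n}
    (hf : DifferentiableAt ℝ f x) (v : Fin m → Euc n) :
    DifferentiableAt ℝ (fun y => f y v) x :=
  (ContinuousMultilinearMap.apply ℝ (fun _ : Fin m => Euc n) ℝ v).differentiableAt.comp x hf

theorem isAlt_fderiv {f : Euc n → FormML n m} {x : Euc n} (hU : IsOpen U) (hx : x ∈ U)
    (hf : DifferentiableAt ℝ f x) (halt : ∀ y ∈ U, IsAlt (f y)) (c : Euc n) :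
    IsAlt (fderiv ℝ f x c) := by
  intro v i j hij hv
  have h : (fun y => f y v) =ᶠ[nhds x] fun _ => 0 := by
    filter_upwards [hU.mem_nhds hx] with y hy using halt y hy v i j hij hv
  rw [← fderiv_form_apply hf, h.fderiv_eq]
  simp

theorem fderiv_fderiv_form_apply {σ : Euc n → FormML n m} {x : Euc n}
    (hσ : DifferentiableAt ℝ (fderiv ℝ σ) x) (b c : Euc n) (a : Fin m → Euc n) :
    fderiv ℝ (fun y => fderiv ℝ σ y c a) x b = fderiv ℝ (fderiv ℝ σ) x b c a := by
  rw [fderiv_form_apply (hσ.clm_apply (differentiableAt_const c)),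
    fderiv_clm_apply hσ (differentiableAt_const c)]
  simp

theorem fderiv_covectorWedge {τ : Euc n → FormML n m} {x : Euc n} (hτ : DifferentiableAt ℝ τ x)
    (b c : Euc n) (a : Fin (m + 1) → Euc n) :
    fderiv ℝ (fun y => covectorWedge c (τ y) a) x b = covectorWedge c (fderiv ℝ τ x b) a := by
  unfold covectorWedge
  rw [fderiv_fun_sum fun i _ => (hτ.form_apply _).const_mul _]
  simp only [sum_apply]
  refine Finset.sum_congr rfl fun i _ => ?_
  rw [fderiv_const_mul (hτ.form_apply _), smul_apply, fderiv_form_apply hτ,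
    smul_eq_mul]

theorem DifferentiableAt.covectorWedge {τ : Euc n → FormML n m} {x : Euc n}
    (hτ : DifferentiableAt ℝ τ x) (c : Euc n) (a : Fin (m + 1) → Euc n) :
    DifferentiableAt ℝ (fun y => covectorWedge c (τ y) a) x := by
  unfold _root_.covectorWedge
  exact DifferentiableAt.fun_sum fun i _ => (hτ.form_apply _).const_mul _

end Derivatives

theorem omitArg_eq_removeNth {X : Type*} (i : Fin (m + 2)) (a : Fin (m + 2) → X) :
    (omitArg i a : Fin (m + 1) → X) = i.removeNth a := by
  funext j
  simp only [omitArg, Fin.removeNth, Fin.succAbove, Fin.lt_def, Fin.val_castSucc]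
  split_ifs <;> rfl

theorem consCast_eq_cons {X : Type*} (c : X) (d : Fin m → X) :
    (consCast (k := m + 1) c d : Fin (m + 1) → X) = Fin.cons c d := by
  funext j
  refine Fin.cases ?_ (fun i => ?_) j
  · simp [consCast]
  · simp [consCast]

theorem ContDiffOn.fderiv_infty {F : Type*} [NormedAddCommGroup F] [NormedSpace ℝ F]
    {U : Set (Euc n)} {f : Euc n → F} (hf : ContDiffOn ℝ (⊤ : ℕ∞) f U) (hU : IsOpen U) :
    ContDiffOn ℝ (⊤ : ℕ∞) (fderiv ℝ f) U :=
  hf.fderiv_of_isOpen hU le_rfl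

theorem exists_killing_of_conformalKilling (hmn : m + 2 < n) {U : Set (Euc n)} (hU : IsOpen U)
    {σ : Euc n → FormML n (m + 2)} {τ : Euc n → FormML n (m + 1)} {ρ : Euc n → FormML n (m + 3)}
    (hσ : ContDiffOn ℝ (⊤ : ℕ∞) σ U) (hτ : ContDiffOn ℝ (⊤ : ℕ∞) τ U)
    (hρ : ContDiffOn ℝ (⊤ : ℕ∞) ρ U) (hσalt : ∀ x ∈ U, IsAlt (σ x))
    (hταlt : ∀ x ∈ U, IsAlt (τ x)) (hρalt : ∀ x ∈ U, IsAlt (ρ x))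
    (heq : ∀ x ∈ U, ∀ (c : Euc n) (a : Fin (m + 2) → Euc n),
      fderiv ℝ σ x c a = covectorWedge c (τ x) a + ρ x (Fin.cons c a)) :
    ∃ ρ' : Euc n → FormML n (m + 2),
      ContDiffOn ℝ (⊤ : ℕ∞) ρ' U ∧ (∀ x ∈ U, IsAlt (ρ' x)) ∧
      ∀ x ∈ U, ∀ (c : Euc n) (d : Fin (m + 1) → Euc n),
        fderiv ℝ (fun y => ∑ p : Fin n, fderiv ℝ σ y (EuclideanSpace.single p (1 : ℝ))
          (Fin.cons (EuclideanSpace.single p (1 : ℝ)) d)) x c = ρ' x (Fin.cons c d) := by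
  have hσ' := hσ.fderiv_infty hU
  have hρ' := hρ.fderiv_infty hU
  have hdiff {F : Type} [NormedAddCommGroup F] [NormedSpace ℝ F] {f : Euc n → F}
      (hf : ContDiffOn ℝ (⊤ : ℕ∞) f U) {x : Euc n} (hx : x ∈ U) : DifferentiableAt ℝ f x :=
    (hf.contDiffAt (hU.mem_nhds hx)).differentiableAt (by simp)
  have hn : (n : ℝ) - (m + 2) ≠ 0 := by
    have : (m : ℝ) + 2 < n := by exact_mod_cast hmn
    linarith
  have hR : ∀ x ∈ U, ∀ b, IsAlt (fderiv ℝ ρ x b) := fun x hx =>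
    isAlt_fderiv hU hx (hdiff hρ hx) hρalt
  let K : ℝ := -(((n : ℝ) - (m + 1)) / ((n : ℝ) - (m + 2)))
  refine ⟨fun x => K • ∑ p : Fin n, (fderiv ℝ ρ x (EuclideanSpace.single p 1)).curryLeft
      (EuclideanSpace.single p 1), ?_, ?_, ?_⟩
  · refine ContDiffOn.const_smul K (ContDiffOn.sum fun p _ => ?_)
    have h := hρ'.clm_apply (contDiffOn_const (c := EuclideanSpace.single p (1 : ℝ)))
    let L : FormML n (m + 3) →L[ℝ] Euc n →L[ℝ] FormML n (m + 2) :=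
      (continuousMultilinearCurryLeftEquiv ℝ (fun _ : Fin (m + 3) => Euc n) ℝ
        ).toContinuousLinearEquiv.toContinuousLinearMap
    exact (L.contDiff.comp_contDiffOn h).clm_apply contDiffOn_const
  · intro x hx v i j hij hv
    rw [smul_apply, sum_apply]
    refine smul_eq_zero_of_right K (Finset.sum_eq_zero fun p _ => ?_)
    exact hR x hx _ _ i.succ j.succ (by simpa using hij) (by simpa using hv)
  · intro x hx c d
    have hS : ∀ b c a, fderiv ℝ (fderiv ℝ σ) x b c a =
        covectorWedge c (fderiv ℝ τ x b) a + fderiv ℝ ρ x b (Fin.cons c a) := fun b c a => by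
      have h : (fun y => fderiv ℝ σ y c a) =ᶠ[nhds x]
          fun y => covectorWedge c (τ y) a + ρ y (Fin.cons c a) := by
        filter_upwards [hU.mem_nhds hx] with y hy using heq y hy c a
      rw [← fderiv_fderiv_form_apply (hdiff hσ' hx), h.fderiv_eq,
        fderiv_fun_add ((hdiff hτ hx).covectorWedge c a) ((hdiff hρ hx).form_apply _),
        add_apply, fderiv_covectorWedge (hdiff hτ hx),
        fderiv_form_apply (hdiff hρ hx)]
    have hSsymm : ∀ b c, fderiv ℝ (fderiv ℝ σ) x b c = fderiv ℝ (fderiv ℝ σ) x c b :=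
      (hσ.contDiffAt (hU.mem_nhds hx)).isSymmSndFDerivAt
        (by
          rw [minSmoothness_of_isRCLikeNormedField]
          exact WithTop.coe_le_coe.mpr (le_top : (2 : ℕ∞) ≤ ⊤))
    have hSalt : ∀ b c, IsAlt (fderiv ℝ (fderiv ℝ σ) x b c) := fun b c => by
      have h := isAlt_fderiv hU hx
        ((hdiff hσ' hx).clm_apply (differentiableAt_const c))
        (fun y hy => isAlt_fderiv hU hy (hdiff hσ hy) hσalt c) b
      rw [fderiv_clm_apply (hdiff hσ' hx) (differentiableAt_const c)] at h
      simpa using h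
    have hT : ∀ b, IsAlt (fderiv ℝ τ x b) := isAlt_fderiv hU hx (hdiff hτ hx) hταlt
    rw [fderiv_fun_sum fun p _ => ((hdiff hσ' hx).clm_apply
      (differentiableAt_const _)).form_apply _]
    simp only [sum_apply, fderiv_fderiv_form_apply (hdiff hσ' hx), smul_apply,
      smul_eq_mul]
    rw [sum_second_derivative_single hT (hR x hx) hS]
    have h := first_derivative_eq_divergence hmn hT (hR x hx) hSalt hSsymm hS c d
    have hsum : ∑ p : Fin n, (fderiv ℝ ρ x (EuclideanSpace.single p 1)).curryLeft
        (EuclideanSpace.single p 1) (Fin.cons c d) =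
        -(((n : ℝ) - (m + 2)) * fderiv ℝ τ x c d) := by
      rw [h, neg_neg]
      rfl
    refine Eq.trans ?_ (congrArg (K * ·) hsum).symm
    simp only [K]
    field_simp

/-- Euclidean helicity lowering. If `σ` is a flat conformal Killing
`k`-form (`2 ≤ k ≤ n-1`) then the codifferential-type `(k-1)`-form
`(δσ)(x)(a₂,…,a_k) = Σₚ (Dσ(x)eₚ)(eₚ,a₂,…,a_k)` is a Killing `(k-1)`-form:
`D(δσ)(x)c = ρ'(x)(c,·)` for a smooth family of `k`-forms `ρ'`. -/
theorem flat_conformal_killing_codifferential_is_Killing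
    (n k : ℕ) (hn : 3 ≤ n) (hk2 : 2 ≤ k) (hkn : k ≤ n - 1)
    (U : Set (Euc n)) (hU : IsOpen U)
    (σ : Euc n → FormML n k) (hσ : FlatCKF n k U σ) :
    ∃ ρ' : Euc n → FormML n k,
      ContDiffOn ℝ (⊤ : ℕ∞) ρ' U ∧ (∀ x ∈ U, IsAlt (ρ' x)) ∧
      ∀ x ∈ U, ∀ (c : Euc n) (d : Fin (k - 1) → Euc n),
        fderiv ℝ
          (fun y => ∑ p : Fin n,
            (fderiv ℝ σ y (EuclideanSpace.single p (1 : ℝ)))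
              (consCast (EuclideanSpace.single p (1 : ℝ)) d)) x c
        = ρ' x (consCast c d) := by
  obtain ⟨m, rfl⟩ : ∃ m, k = m + 2 := ⟨k - 2, by omega⟩
  obtain ⟨hσs, hσalt, τ, ρ, hτ, hρ, hτalt, hρalt, heq⟩ := hσ
  obtain ⟨ρ', hρ's, hρ'alt, h⟩ := exists_killing_of_conformalKilling (m := m) (by omega) hU
    (τ := τ) (ρ := ρ) hσs hτ hρ hσalt hτalt hρalt fun x hx c a => by
      rw [heq x hx c a, covectorWedge, ← consCast_eq_cons]
      simp_rw [← omitArg_eq_removeNth]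
  refine ⟨ρ', hρ's, hρ'alt, fun x hx c d => ?_⟩
  have h' := h x hx c d
  simp_rw [← consCast_eq_cons] at h'
  exact h'
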